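/- arXiv:1607.01263 — 3 statements merged into one kernel-verified Lean document; each statement's English description precedes it below -/
import Mathlib

section
/- Let F be a field and C₂ ⊊ C₁ ⊆ F^{m×n} nested linear codes. Then K_{M,0}(C₁,C₂) = 0, K_{M,n}(C₁,C₂) = dim(C₁/C₂), and for every 0 ≤ μ ≤ n−1 it holds that 0 ≤ K_{M,μ+1}(C₁,C₂) − K_{M,μ}(C₁,C₂) ≤ m. -/
noncomputable section

open Matrix

variable {F : Type*} [Field F]

/-- The row space of a matrix: the span of its rows. -/
def rowSpace {m n : ℕ} (C : Matrix (Fin m) (Fin n) F) : Submodule F (Fin n → F) :=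
  Submodule.span F (Set.range C)

/-- The rank support space of a subspace `L ⊆ F^n`:
all `m × n` matrices whose row space is contained in `L`. -/
def rss (m : ℕ) {n : ℕ} (L : Submodule F (Fin n → F)) :
    Submodule F (Matrix (Fin m) (Fin n) F) where
  carrier := {V | rowSpace V ≤ L}
  add_mem' := by
    intro a b ha hb
    simp only [Set.mem_setOf_eq, rowSpace, Submodule.span_le] at *
    rintro x ⟨i, rfl⟩
    exact L.add_mem (ha (Set.mem_range_self i)) (hb (Set.mem_range_self i))
  zero_mem' := by
    simp only [Set.mem_setOf_eq, rowSpace, Submodule.span_le]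
    rintro x ⟨i, rfl⟩
    exact L.zero_mem
  smul_mem' := by
    intro c a ha
    simp only [Set.mem_setOf_eq, rowSpace, Submodule.span_le] at *
    rintro x ⟨i, rfl⟩
    exact L.smul_mem c (ha (Set.mem_range_self i))

/-- The `μ`-th relative dimension/rank support profile of a pair of nested linear codes. -/
def KM {m n : ℕ} (C₁ C₂ : Submodule F (Matrix (Fin m) (Fin n) F)) (μ : ℕ) : ℕ :=
  sSup { k | ∃ L : Submodule F (Fin n → F), Module.finrank F L ≤ μ ∧
    k = Module.finrank F ↥(C₁ ⊓ rss m L) - Module.finrank F ↥(C₂ ⊓ rss m L) }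

open Module

theorem mem_rss {m n : ℕ} {L : Submodule F (Fin n → F)} {V : Matrix (Fin m) (Fin n) F} :
    V ∈ rss m L ↔ ∀ i, V i ∈ L := by
  change Submodule.span F (Set.range V) ≤ L ↔ _
  rw [Submodule.span_le]
  exact Set.range_subset_iff

theorem rss_mono {m n : ℕ} {L L' : Submodule F (Fin n → F)} (h : L ≤ L') :
    rss m L ≤ rss m L' :=
  fun _ hV => mem_rss.2 fun i => h (mem_rss.1 hV i)

theorem rss_bot {m n : ℕ} : rss m (⊥ : Submodule F (Fin n → F)) = ⊥ := by
  rw [eq_bot_iff]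
  intro V hV
  rw [Submodule.mem_bot]
  ext i j
  exact congrFun ((Submodule.mem_bot F).1 (mem_rss.1 hV i)) j

theorem rss_top {m n : ℕ} : rss m (⊤ : Submodule F (Fin n → F)) = ⊤ :=
  eq_top_iff.2 fun _ _ => mem_rss.2 fun _ => Submodule.mem_top

/-- Intersecting with a subspace does not increase relative dimension. -/
theorem finrank_inf_sub_finrank_inf_le {E : Type*} [AddCommGroup E] [Module F E]
    [FiniteDimensional F E] {A B : Submodule F E} (hBA : B ≤ A) (W : Submodule F E) :
    finrank F ↥(A ⊓ W) - finrank F ↥(B ⊓ W) ≤ finrank F A - finrank F B := by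
  have h := Submodule.finrank_sup_add_finrank_inf_eq (A ⊓ W) B
  have hinf : A ⊓ W ⊓ B = B ⊓ W := by
    rw [inf_right_comm, inf_eq_right.2 hBA]
  have hsup : finrank F ↥(A ⊓ W ⊔ B) ≤ finrank F A :=
    Submodule.finrank_mono (sup_le inf_le_left hBA)
  rw [hinf] at h
  omega

/-- Intersecting with the kernel of a linear map into `G` lowers the dimension by at most
`dim G`. -/
theorem finrank_le_finrank_inf_ker_add {E G : Type*} [AddCommGroup E] [Module F E]
    [FiniteDimensional F E] [AddCommGroup G] [Module F G] [FiniteDimensional F G]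
    (f : E →ₗ[F] G) (W : Submodule F E) :
    finrank F W ≤ finrank F ↥(W ⊓ LinearMap.ker f) + finrank F G := by
  have h₁ := Submodule.finrank_sup_add_finrank_inf_eq W (LinearMap.ker f)
  have h₂ := f.finrank_range_add_finrank_ker
  have h₃ := Submodule.finrank_le (LinearMap.range f)
  have h₄ := Submodule.finrank_le (W ⊔ LinearMap.ker f)
  omega

/-- Passing to the hyperplane `v j = 0` of a row support lowers the dimension of the corresponding
part of a code by at most the number of rows. -/
theorem finrank_inf_rss_le {m n : ℕ} (C : Submodule F (Matrix (Fin m) (Fin n) F))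
    (L : Submodule F (Fin n → F)) (j : Fin n) :
    finrank F ↥(C ⊓ rss m L) ≤
      finrank F ↥(C ⊓ rss m (L ⊓ LinearMap.ker (LinearMap.proj j))) + m := by
  let f : Matrix (Fin m) (Fin n) F →ₗ[F] (Fin m → F) :=
    { toFun := fun V i => V i j
      map_add' := fun _ _ => rfl
      map_smul' := fun _ _ => rfl }
  have h := finrank_le_finrank_inf_ker_add f (C ⊓ rss m L)
  rw [finrank_fin_fun] at h
  refine h.trans (Nat.add_le_add_right (Submodule.finrank_mono ?_) m)
  rintro V ⟨⟨hC, hL⟩, hV⟩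
  exact ⟨hC, mem_rss.2 fun i => ⟨mem_rss.1 hL i, congrFun (LinearMap.mem_ker.1 hV) i⟩⟩

/-- A subspace of dimension at most `μ + 1` has a subspace of dimension at most `μ` for which the
corresponding part of any code has dimension smaller by at most the number of rows. -/
theorem exists_le_finrank_inf_rss_le {m n μ : ℕ} (L : Submodule F (Fin n → F))
    (hL : finrank F L ≤ μ + 1) :
    ∃ L' ≤ L, finrank F L' ≤ μ ∧ ∀ C : Submodule F (Matrix (Fin m) (Fin n) F),
      finrank F ↥(C ⊓ rss m L) ≤ finrank F ↥(C ⊓ rss m L') + m := by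
  rcases eq_or_ne L ⊥ with rfl | hne
  · exact ⟨⊥, le_rfl, by simp, fun C => Nat.le_add_right _ _⟩
  obtain ⟨v, hv, hv0⟩ := Submodule.exists_mem_ne_zero_of_ne_bot hne
  obtain ⟨j, hj⟩ := Function.ne_iff.1 hv0
  refine ⟨L ⊓ LinearMap.ker (LinearMap.proj j), inf_le_left, ?_,
    fun C => finrank_inf_rss_le C L j⟩
  have hlt : L ⊓ LinearMap.ker (LinearMap.proj j) < L :=
    inf_lt_left.2 fun h => hj (LinearMap.mem_ker.1 (h hv))
  have := Submodule.finrank_lt_finrank_of_lt hlt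
  omega

theorem KM_le_iff {m n : ℕ} {C₁ C₂ : Submodule F (Matrix (Fin m) (Fin n) F)} {μ k : ℕ} :
    KM C₁ C₂ μ ≤ k ↔ ∀ L : Submodule F (Fin n → F), finrank F L ≤ μ →
      finrank F ↥(C₁ ⊓ rss m L) - finrank F ↥(C₂ ⊓ rss m L) ≤ k := by
  have hbdd : BddAbove { k | ∃ L : Submodule F (Fin n → F), finrank F L ≤ μ ∧
      k = finrank F ↥(C₁ ⊓ rss m L) - finrank F ↥(C₂ ⊓ rss m L) } := by
    refine ⟨finrank F (Matrix (Fin m) (Fin n) F), ?_⟩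
    rintro _ ⟨L, -, rfl⟩
    exact (Nat.sub_le _ _).trans (Submodule.finrank_le _)
  unfold KM
  rw [csSup_le_iff hbdd ⟨_, ⊥, by simp, rfl⟩]
  constructor
  · intro h L hL
    exact h _ ⟨L, hL, rfl⟩
  · rintro h _ ⟨L, hL, rfl⟩
    exact h L hL

theorem le_KM {m n : ℕ} (C₁ C₂ : Submodule F (Matrix (Fin m) (Fin n) F)) {μ : ℕ}
    {L : Submodule F (Fin n → F)} (hL : finrank F L ≤ μ) :
    finrank F ↥(C₁ ⊓ rss m L) - finrank F ↥(C₂ ⊓ rss m L) ≤ KM C₁ C₂ μ :=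
  KM_le_iff.1 le_rfl L hL

/-- Monotonicity of relative dimension/rank support profiles:
`K_{M,0} = 0`, `K_{M,n} = dim(C₁/C₂)` and `0 ≤ K_{M,μ+1} - K_{M,μ} ≤ m`. -/
theorem stmt_4 (m n : ℕ) (C₁ C₂ : Submodule F (Matrix (Fin m) (Fin n) F))
    (h21 : C₂ ≤ C₁) (hne : C₂ ≠ C₁) :
    KM C₁ C₂ 0 = 0 ∧
    KM C₁ C₂ n = Module.finrank F ↥C₁ - Module.finrank F ↥C₂ ∧
    (∀ μ : ℕ, μ ≤ n - 1 →
      KM C₁ C₂ μ ≤ KM C₁ C₂ (μ + 1) ∧ KM C₁ C₂ (μ + 1) ≤ KM C₁ C₂ μ + m) := by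
  refine ⟨?_, ?_, fun μ _ => ⟨?_, ?_⟩⟩
  · rw [← Nat.le_zero, KM_le_iff]
    intro L hL
    rw [Submodule.finrank_eq_zero.1 (Nat.le_zero.1 hL), rss_bot, inf_bot_eq, inf_bot_eq,
      Nat.sub_self]
  · refine le_antisymm ?_ ?_
    · rw [KM_le_iff]
      exact fun L _ => finrank_inf_sub_finrank_inf_le h21 (rss m L)
    · have h := le_KM C₁ C₂ (μ := n) (L := ⊤) (by simp)
      rwa [rss_top, inf_top_eq, inf_top_eq] at h
  · rw [KM_le_iff]
    exact fun L hL => le_KM C₁ C₂ (Nat.le_succ_of_le hL)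
  · rw [KM_le_iff]
    intro L hL
    obtain ⟨L', hle, hL', hC⟩ := exists_le_finrank_inf_rss_le (m := m) L hL
    have h₁ := hC C₁
    have h₂ : finrank F ↥(C₂ ⊓ rss m L') ≤ finrank F ↥(C₂ ⊓ rss m L) :=
      Submodule.finrank_mono (inf_le_inf_left C₂ (rss_mono hle))
    have h₃ := le_KM C₁ C₂ hL'
    omega

end
end

section
/- For every prime power q, all positive integers m and n, and every positive integer ℓ ≤ mn, there exists a linear code C ⊊ F_q^{m×n} with dim(C^⊥) = ℓ whose security parameter attains the Singleton bound: the minimum rank of a nonzero matrix in C^⊥ equals min{m,n} − ⌈ℓ / max{m,n}⌉ + 1, i.e., t = d_R(C^⊥) − 1 = min{m,n} − ⌈ℓ / max{m,n}⌉. -/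
noncomputable section

open Matrix

variable {F : Type*} [Field F]

/-- The rank of a matrix, as the dimension of its row space. -/
def Rk {m n : ℕ} (C : Matrix (Fin m) (Fin n) F) : ℕ :=
  Module.finrank F (rowSpace C)

/-- The dual of a space of matrices under the trace (Hilbert–Schmidt) product
`⟨C, D⟩ = Trace (C * Dᵀ)`. -/
def traceDual {m n : ℕ} (C : Submodule F (Matrix (Fin m) (Fin n) F)) :
    Submodule F (Matrix (Fin m) (Fin n) F) where
  carrier := {D | ∀ C' ∈ C, Matrix.trace (C' * D.transpose) = 0}
  add_mem' := by
    intro a b ha hb C' hC'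
    simp [Matrix.transpose_add, Matrix.mul_add, Matrix.trace_add, ha C' hC', hb C' hC']
  zero_mem' := by
    intro C' hC'
    simp
  smul_mem' := by
    intro c a ha C' hC'
    simp [Matrix.transpose_smul, Matrix.mul_smul, Matrix.trace_smul, ha C' hC']

/-- The minimum rank distance of a (nonzero) linear code of matrices. -/
def dRmin {m n : ℕ} (D : Submodule F (Matrix (Fin m) (Fin n) F)) : ℕ :=
  sInf { k | ∃ M ∈ D, M ≠ 0 ∧ k = Rk M }

/-- A linearized polynomial `∑ i < s, a i * x ^ q ^ i` that is nonzero vanishes on a subspace of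
dimension less than `s`. -/
lemma finrank_lt_of_linearized_vanishing [Fintype F] {K : Type*} [Field K] [Algebra F K]
    {s : ℕ} {a : Fin s → K} (ha : a ≠ 0) {V : Type*} [AddCommGroup V]
    [Module F V] [FiniteDimensional F V] (g : V →ₗ[F] K) (hg : Function.Injective g)
    (h : ∀ v, ∑ i, a i * g v ^ Fintype.card F ^ (i : ℕ) = 0) :
    Module.finrank F V < s := by
  classical
  have hq : 1 < Fintype.card F := Fintype.one_lt_card
  let P : Polynomial K := ∑ i : Fin s, Polynomial.C (a i) * Polynomial.X ^ Fintype.card F ^ (i : ℕ)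
  have hP : P ≠ 0 := by
    obtain ⟨j, hj⟩ := Function.ne_iff.mp ha
    intro h0
    apply hj
    have hc : P.coeff (Fintype.card F ^ (j : ℕ)) = a j := by
      simp only [P, Polynomial.finsetSum_coeff, Polynomial.coeff_C_mul_X_pow]
      rw [Finset.sum_eq_single j]
      · simp
      · intro b _ hb
        rw [if_neg]
        intro hbj
        exact hb (Fin.ext (Nat.pow_right_injective hq hbj).symm)
      · simp
    rw [← hc, h0]
    simp
  have hs : 0 < s := by
    obtain ⟨j, -⟩ := Function.ne_iff.mp ha
    exact j.pos
  have hdeg : P.natDegree ≤ Fintype.card F ^ (s - 1) := by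
    apply Polynomial.natDegree_sum_le_of_forall_le
    intro i _
    refine (Polynomial.natDegree_C_mul_X_pow_le _ _).trans ?_
    exact Nat.pow_le_pow_right hq.le (by omega)
  have : Finite V := Module.finite_of_finite F
  have := Fintype.ofFinite V
  have hcard : Fintype.card V ≤ P.natDegree := by
    rw [← Finset.card_univ, ← Finset.card_image_of_injective Finset.univ hg]
    apply Polynomial.card_le_degree_of_subset_roots
    intro x hx
    obtain ⟨v, -, rfl⟩ := Finset.mem_image.mp hx
    rw [Polynomial.mem_roots hP]
    simpa [P, Polynomial.IsRoot, Polynomial.eval_finsetSum] using h v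
  rw [Module.card_eq_pow_finrank (K := F)] at hcard
  have := (Nat.pow_le_pow_iff_right hq).mp (hcard.trans hdeg)
  omega

/-- Maximum rank distance (Gabidulin) codes exist. -/
lemma exists_gabidulin_code [Fintype F] {M N s : ℕ} (hM : 0 < M) (hNM : N ≤ M)
    (hsN : s ≤ N) :
    ∃ D : Submodule F (Matrix (Fin M) (Fin N) F), Module.finrank F D = s * M ∧
      ∀ A ∈ D, A ≠ 0 → N < A.rank + s := by
  classical
  obtain ⟨p, hp⟩ := CharP.exists F
  have : Fact p.Prime := ⟨CharP.char_is_prime F p⟩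
  have : NeZero M := ⟨hM.ne'⟩
  let K := FiniteField.Extension F p M
  have hK : Module.finrank F K = M := FiniteField.finrank_extension F p M
  let e : K ≃ₗ[F] (Fin M → F) := LinearEquiv.ofFinrankEq _ _ (by simp [hK])
  obtain ⟨v, hv⟩ := exists_linearIndependent_of_le_finrank (R := F) (M := K) (hNM.trans_eq hK.symm)
  let ι : (Fin N → F) →ₗ[F] K := Fintype.linearCombination F v
  have hι : Function.Injective ι := linearIndependent_iff_injective_fintypeLinearCombination.mp hv
  let φ : (Fin s → K) →ₗ[F] (K →ₗ[F] K) := ∑ i : Fin s,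
    (LinearMap.lcomp F K ((FiniteField.frobeniusAlgHom F K) ^ (i : ℕ)).toLinearMap ∘ₗ
      LinearMap.mul F K) ∘ₗ LinearMap.proj i
  have hφ (a x) : φ a x = ∑ i, a i * x ^ Fintype.card F ^ (i : ℕ) := by
    simp [φ, FiniteField.coe_frobeniusAlgHom, pow_iterate]
  let ψ : (Fin s → K) →ₗ[F] Matrix (Fin M) (Fin N) F :=
    LinearMap.toMatrix'.toLinearMap ∘ₗ (LinearMap.llcomp F (Fin N → F) K (Fin M → F) e) ∘ₗ
      (LinearMap.lcomp F K ι) ∘ₗ φ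
  have hψ (a w) : (ψ a).mulVecLin w = e (φ a (ι w)) := by
    simp [ψ]
  have hker (a : Fin s → K) (ha : a ≠ 0) :
      Module.finrank F (LinearMap.ker (ψ a).mulVecLin) < s := by
    refine finrank_lt_of_linearized_vanishing ha (ι ∘ₗ Submodule.subtype _)
      (hι.comp Subtype.val_injective) fun w => ?_
    have := w.2
    rw [LinearMap.mem_ker, hψ, map_eq_zero_iff _ e.injective, hφ] at this
    exact this
  have hrank (a : Fin s → K) (ha : a ≠ 0) : N < (ψ a).rank + s := by
    have h1 := (ψ a).mulVecLin.finrank_range_add_finrank_ker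
    have h2 := hker a ha
    rw [Module.finrank_fin_fun] at h1
    change (ψ a).rank + _ = N at h1
    omega
  have hinj : Function.Injective ψ := by
    rw [injective_iff_map_eq_zero]
    intro a h0
    by_contra ha
    have := hrank a ha
    rw [h0, Matrix.rank_zero] at this
    omega
  refine ⟨LinearMap.range ψ, ?_, ?_⟩
  · rw [LinearMap.finrank_range_of_inj hinj, Module.finrank_pi_fintype]
    simp [hK]
  · rintro _ ⟨a, rfl⟩ hA
    exact hrank a fun h => hA (by rw [h, map_zero])

/-- A matrix whose first `s` columns vanish has rank at most the number of remaining columns. -/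
lemma rank_add_le_of_columns_eq_zero {M N s : ℕ} (hs : s ≤ N)
    (A : Matrix (Fin M) (Fin N) F) (hA : ∀ i j, j.val < s → A i j = 0) : A.rank + s ≤ N := by
  classical
  have h : LinearMap.range (Function.ExtendByZero.linearMap F (Fin.castLE hs)) ≤
      LinearMap.ker A.mulVecLin := by
    rintro _ ⟨w, rfl⟩
    ext i
    simp only [Matrix.mulVecLin_apply, Matrix.mulVec, dotProduct, Pi.zero_apply]
    refine Finset.sum_eq_zero fun j _ => ?_
    by_cases hj : j.val < s
    · rw [hA i j hj, zero_mul]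
    · rw [Function.ExtendByZero.linearMap_apply, Function.extend_apply', Pi.zero_apply, mul_zero]
      rintro ⟨k, rfl⟩
      exact hj k.2
  have h1 := Submodule.finrank_mono h
  rw [LinearMap.finrank_range_of_inj
    (Function.extend_injective (Fin.castLE_injective hs) 0), Module.finrank_fin_fun] at h1
  have h2 := A.mulVecLin.finrank_range_add_finrank_ker
  rw [Module.finrank_fin_fun] at h2
  change A.rank + _ = N at h2
  omega

/-- The Singleton bound for linear rank-metric codes. -/
lemma exists_rank_add_le_of_lt_finrank {M N s : ℕ} (hs : s ≤ N)
    (D : Submodule F (Matrix (Fin M) (Fin N) F)) (hD : s * M < Module.finrank F D) :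
    ∃ A ∈ D, A ≠ 0 ∧ A.rank + s ≤ N := by
  let f : Matrix (Fin M) (Fin N) F →ₗ[F] (Fin s → Fin M → F) :=
    { toFun A k i := A i (Fin.castLE hs k)
      map_add' _ _ := rfl
      map_smul' _ _ := rfl }
  have hf : LinearMap.ker (f ∘ₗ D.subtype) ≠ ⊥ :=
    LinearMap.ker_ne_bot_of_finrank_lt (by simpa [Module.finrank_pi_fintype] using hD)
  obtain ⟨A, hA, hA0⟩ := Submodule.exists_mem_ne_zero_of_ne_bot hf
  refine ⟨A, A.2, by simpa using hA0, rank_add_le_of_columns_eq_zero hs _ fun i j hj => ?_⟩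
  exact congrFun (congrFun (LinearMap.mem_ker.mp hA) ⟨j, hj⟩) i

lemma exists_submodule_le_finrank_eq {V : Type*} [AddCommGroup V] [Module F V]
    (W : Submodule F V) {k : ℕ} (hk : k ≤ Module.finrank F W) :
    ∃ U ≤ W, Module.finrank F U = k := by
  obtain ⟨v, hv⟩ := exists_linearIndependent_of_le_finrank hk
  refine ⟨(Submodule.span F (Set.range v)).map W.subtype, Submodule.map_subtype_le _ _, ?_⟩
  rw [Submodule.finrank_map_subtype_eq]
  simpa using finrank_span_eq_card hv

/-- Codes of every dimension attaining the Singleton bound, for matrices with at least as many rows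
as columns. -/
lemma exists_optimal_code_of_le [Fintype F] {M N r ℓ : ℕ} (hM : 0 < M) (hNM : N ≤ M)
    (hrN : r + 1 ≤ N) (hl : r * M < ℓ) (hu : ℓ ≤ (r + 1) * M) :
    ∃ D : Submodule F (Matrix (Fin M) (Fin N) F), Module.finrank F D = ℓ ∧
      (∀ A ∈ D, A ≠ 0 → N ≤ A.rank + r) ∧ ∃ A ∈ D, A ≠ 0 ∧ A.rank + r = N := by
  obtain ⟨G, hG, hGr⟩ := exists_gabidulin_code (F := F) hM hNM hrN
  obtain ⟨D, hDG, hD⟩ := exists_submodule_le_finrank_eq G (hu.trans_eq hG.symm)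
  have hlow : ∀ A ∈ D, A ≠ 0 → N ≤ A.rank + r := fun A hA hA0 => by
    have := hGr A (hDG hA) hA0
    omega
  obtain ⟨A, hA, hA0, hAr⟩ := exists_rank_add_le_of_lt_finrank (by omega : r ≤ N) D (hD ▸ hl)
  exact ⟨D, hD, hlow, A, hA, hA0, hAr.antisymm (hlow A hA hA0)⟩

lemma exists_optimal_code [Fintype F] {m n r ℓ : ℕ} (hm : 0 < m) (hn : 0 < n)
    (hr : r + 1 ≤ min m n) (hl : r * max m n < ℓ) (hu : ℓ ≤ (r + 1) * max m n) :
    ∃ D : Submodule F (Matrix (Fin m) (Fin n) F), Module.finrank F D = ℓ ∧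
      (∀ A ∈ D, A ≠ 0 → min m n ≤ A.rank + r) ∧ ∃ A ∈ D, A ≠ 0 ∧ A.rank + r = min m n := by
  rcases le_total n m with h | h
  · rw [min_eq_right h] at hr ⊢
    rw [max_eq_left h] at hl hu
    exact exists_optimal_code_of_le hm h hr hl hu
  · rw [min_eq_left h] at hr ⊢
    rw [max_eq_right h] at hl hu
    obtain ⟨D, hD, hlow, A, hA, hA0, hAr⟩ := exists_optimal_code_of_le (F := F) hn h hr hl hu
    let T := Matrix.transposeLinearEquiv (Fin n) (Fin m) F F
    refine ⟨D.map T.toLinearMap, ?_, ?_, Aᵀ, ⟨A, hA, rfl⟩, by simpa using hA0,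
      by rwa [Matrix.rank_transpose]⟩
    · exact (LinearEquiv.finrank_map_eq T D).trans hD
    · rintro _ ⟨B, hB, rfl⟩ hB0
      have hB' : B ≠ 0 := fun h => hB0 (by rw [h, map_zero])
      change m ≤ Bᵀ.rank + r
      rw [Matrix.rank_transpose]
      exact hlow B hB hB'

lemma Rk_eq_rank {m n : ℕ} (A : Matrix (Fin m) (Fin n) F) : Rk A = A.rank :=
  A.rank_eq_finrank_span_row.symm

/-- The trace product `(C, D) ↦ Trace (C * Dᵀ)` as a bilinear form. -/
def traceProduct (F : Type*) [Field F] (m n : ℕ) :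
    LinearMap.BilinForm F (Matrix (Fin m) (Fin n) F) :=
  LinearMap.mk₂ F (fun C D => Matrix.trace (C * Dᵀ))
    (by intros; simp [Matrix.add_mul])
    (by intros; simp)
    (by intros; simp [Matrix.mul_add])
    (by intros; simp)

lemma traceProduct_isSymm (m n : ℕ) : (traceProduct F m n).IsSymm := by
  refine ⟨fun C D => ?_⟩
  change Matrix.trace (C * Dᵀ) = Matrix.trace (D * Cᵀ)
  rw [← Matrix.trace_transpose, Matrix.transpose_mul, Matrix.transpose_transpose]

lemma traceProduct_nondegenerate (m n : ℕ) : (traceProduct F m n).Nondegenerate := by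
  have hrefl : LinearMap.IsRefl (traceProduct F m n) := (traceProduct_isSymm m n).isRefl
  refine hrefl.nondegenerate_iff_separatingLeft.mpr ?_
  intro C hC
  refine Matrix.ext_iff_trace_mul_right.mpr fun X => ?_
  simpa [traceProduct] using hC Xᵀ

lemma traceDual_eq_orthogonal {m n : ℕ} (C : Submodule F (Matrix (Fin m) (Fin n) F)) :
    traceDual C = (traceProduct F m n).orthogonal C :=
  rfl

lemma traceDual_traceDual {m n : ℕ} (C : Submodule F (Matrix (Fin m) (Fin n) F)) :
    traceDual (traceDual C) = C := by
  simp only [traceDual_eq_orthogonal]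
  exact LinearMap.BilinForm.orthogonal_orthogonal (traceProduct_nondegenerate m n)
    (traceProduct_isSymm m n).isRefl C

lemma traceDual_bot {m n : ℕ} : traceDual (⊥ : Submodule F (Matrix (Fin m) (Fin n) F)) = ⊤ := by
  rw [traceDual_eq_orthogonal, LinearMap.BilinForm.orthogonal_bot]

/-- Existence of optimal universal secure linear coset coding schemes for
noiseless networks, for all field sizes `q`, all `m`, `n` and all information parameters
`1 ≤ ℓ ≤ mn`: there is a linear code `C ⊊ F_q^{m×n}` with `dim C^⊥ = ℓ` and
`d_R(C^⊥) = min{m,n} - ⌈ℓ / max{m,n}⌉ + 1`, i.e. security parameter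
`t = min{m,n} - ⌈ℓ / max{m,n}⌉`. -/
theorem stmt_9 (q : ℕ) (hq : IsPrimePow q) (F : Type*) [Field F] [Fintype F]
    (hFq : Fintype.card F = q) (m n : ℕ) (hm : 0 < m) (hn : 0 < n)
    (ℓ : ℕ) (hℓ1 : 1 ≤ ℓ) (hℓ2 : ℓ ≤ m * n) :
    ∃ C : Submodule F (Matrix (Fin m) (Fin n) F), C ≠ ⊤ ∧
      Module.finrank F ↥(traceDual C) = ℓ ∧
      dRmin (traceDual C) = min m n - ⌈(ℓ : ℚ) / (max m n : ℚ)⌉₊ + 1 := by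
  have hM : 0 < max m n := lt_max_of_lt_left hm
  set k := ⌈(ℓ : ℚ) / (max m n : ℚ)⌉₊ with hk
  have hMQ : (0 : ℚ) < max (m : ℚ) n := by exact_mod_cast hM
  have hkle (j : ℕ) : k ≤ j ↔ ℓ ≤ j * max m n := by
    rw [hk, Nat.ceil_le, div_le_iff₀ hMQ]
    exact_mod_cast Iff.rfl
  have hk0 : 0 < k := Nat.pos_of_ne_zero fun h => by
    have := (hkle 0).mp h.le
    omega
  obtain ⟨r, hr⟩ : ∃ r, k = r + 1 := ⟨k - 1, by omega⟩
  have hrN : r + 1 ≤ min m n := by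
    rw [← hr, hkle, min_mul_max]
    exact hℓ2
  have hl : r * max m n < ℓ := not_le.mp fun h => by
    have := (hkle r).mpr h
    omega
  obtain ⟨D, hD, hlow, A, hA, hA0, hAr⟩ :=
    exists_optimal_code (F := F) hm hn hrN hl ((hkle (r + 1)).mp hr.le)
  refine ⟨traceDual D, fun h => ?_, ?_, ?_⟩
  · have hbot : D = ⊥ := by
      rw [← traceDual_traceDual D, h, ← traceDual_bot, traceDual_traceDual]
    rw [hbot, finrank_bot] at hD
    omega
  · rw [traceDual_traceDual, hD]
  · rw [traceDual_traceDual, hr]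
    apply le_antisymm
    · refine Nat.sInf_le ⟨A, hA, hA0, ?_⟩
      rw [Rk_eq_rank]
      omega
    · refine le_csInf ⟨_, A, hA, hA0, rfl⟩ ?_
      rintro _ ⟨B, hB, hB0, rfl⟩
      have := hlow B hB hB0
      rw [Rk_eq_rank]
      omega

end
end

section
/- Let F be a field and C₂ ⊊ C₁ ⊆ F^{m×n} nested linear codes with ℓ = dim(C₁/C₂). Then for every 1 ≤ r ≤ ℓ, d_{M,r}(C₁,C₂) ≤ n − ⌈(ℓ − r + 1)/m⌉ + 1. In particular, dim(C₁/C₂) ≤ max{m,n}·(min{m,n} − d_R(C₁,C₂) + 1), where d_R(C₁,C₂) = min{Rk(C) : C ∈ C₁, C ∉ C₂}. -/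
noncomputable section

open Matrix

variable {F : Type*} [Field F]

/-- The `r`-th relative generalized matrix weight of a pair of nested linear codes. -/
def dM {m n : ℕ} (C₁ C₂ : Submodule F (Matrix (Fin m) (Fin n) F)) (r : ℕ) : ℕ :=
  sInf { d | ∃ L : Submodule F (Fin n → F), Module.finrank F L = d ∧
    Module.finrank F ↥(C₁ ⊓ rss m L) - Module.finrank F ↥(C₂ ⊓ rss m L) ≥ r }

/-- The minimum rank distance of a pair of nested linear codes. -/
def dRrel {m n : ℕ} (C₁ C₂ : Submodule F (Matrix (Fin m) (Fin n) F)) : ℕ :=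
  sInf { k | ∃ M ∈ C₁, M ∉ C₂ ∧ k = Rk M }

theorem mem_rss_iff {m n : ℕ} {L : Submodule F (Fin n → F)} {M : Matrix (Fin m) (Fin n) F} :
    M ∈ rss m L ↔ ∀ i, M i ∈ L :=
  Submodule.span_le.trans Set.range_subset_iff

/-- The rank support space of `L` is the space of `m`-tuples of vectors of `L`. -/
def rssEquiv (m : ℕ) {n : ℕ} (L : Submodule F (Fin n → F)) : rss m L ≃ₗ[F] (Fin m → L) where
  toFun M i := ⟨M.1 i, mem_rss_iff.1 M.2 i⟩
  invFun v := ⟨fun i => (v i : Fin n → F), mem_rss_iff.2 fun i => (v i).2⟩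
  map_add' _ _ := rfl
  map_smul' _ _ := rfl
  left_inv _ := rfl
  right_inv _ := rfl

theorem finrank_rss (m : ℕ) {n : ℕ} (L : Submodule F (Fin n → F)) :
    Module.finrank F (rss m L) = m * Module.finrank F L := by
  rw [(rssEquiv m L).finrank_eq, Module.finrank_pi_fintype]
  simp

theorem exists_submodule_finrank_eq {n d : ℕ} (hd : d ≤ n) :
    ∃ L : Submodule F (Fin n → F), Module.finrank F L = d := by
  refine ⟨Submodule.span F (Set.range (Pi.basisFun F (Fin n) ∘ Fin.castLE hd)), ?_⟩
  rw [finrank_span_eq_card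
    ((Pi.basisFun F (Fin n)).linearIndependent.comp _ (Fin.castLE_injective hd)),
    Fintype.card_fin]

/-- If the relative dimension is at least `r + m * s`, then some subspace of codimension `s`
supports a relative dimension of at least `r`. -/
theorem exists_support {m n r s : ℕ} {C₁ C₂ : Submodule F (Matrix (Fin m) (Fin n) F)}
    (hs : s ≤ n)
    (hr : r + m * s ≤ Module.finrank F C₁ - Module.finrank F C₂) :
    ∃ L : Submodule F (Fin n → F), Module.finrank F L = n - s ∧
      Module.finrank F ↥(C₁ ⊓ rss m L) - Module.finrank F ↥(C₂ ⊓ rss m L) ≥ r := by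
  obtain ⟨L, hL⟩ := exists_submodule_finrank_eq (F := F) (Nat.sub_le n s)
  refine ⟨L, hL, ?_⟩
  have h := Submodule.finrank_sup_add_finrank_inf_eq C₁ (rss m L)
  have h₁ := Submodule.finrank_le (C₁ ⊔ rss m L)
  have h₂ := Submodule.finrank_mono (inf_le_left : C₂ ⊓ rss m L ≤ C₂)
  have hV : Module.finrank F (rss m L) + m * s = m * n := by
    rw [finrank_rss, hL, ← mul_add, Nat.sub_add_cancel hs]
  have hE : Module.finrank F (Matrix (Fin m) (Fin n) F) = m * n := by
    simp [Module.finrank_matrix]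
  omega

theorem finrank_sub_finrank_le {m n : ℕ} (C₁ C₂ : Submodule F (Matrix (Fin m) (Fin n) F)) :
    Module.finrank F C₁ - Module.finrank F C₂ ≤ m * n := by
  have h := Submodule.finrank_le C₁
  rw [Module.finrank_matrix] at h
  simp only [Fintype.card_fin, Module.finrank_self, mul_one] at h
  omega

theorem finrank_sub_finrank_le_mul_dRrel {m n : ℕ}
    (C₁ C₂ : Submodule F (Matrix (Fin m) (Fin n) F)) :
    Module.finrank F C₁ - Module.finrank F C₂ ≤ m * (n - dRrel C₁ C₂ + 1) := by
  by_contra! hlt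
  obtain hd | hd := Nat.eq_zero_or_pos (dRrel C₁ C₂)
  · have := finrank_sub_finrank_le C₁ C₂
    rw [hd, Nat.sub_zero, mul_add] at hlt
    omega
  have key : ∀ s ≤ n, m * s < Module.finrank F C₁ - Module.finrank F C₂ →
      dRrel C₁ C₂ ≤ n - s := by
    intro s hs hlt
    obtain ⟨L, hL, hr⟩ := exists_support (C₁ := C₁) (C₂ := C₂) (r := 1) hs (by omega)
    have hnle : ¬ C₁ ⊓ rss m L ≤ C₂ ⊓ rss m L := fun hle => by
      have := Submodule.finrank_mono hle
      omega
    obtain ⟨M, ⟨hM₁, hML⟩, hM⟩ := SetLike.not_le_iff_exists.1 hnle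
    have hM₂ : M ∉ C₂ := fun h => hM ⟨h, hML⟩
    have hd : dRrel C₁ C₂ ≤ Rk M := Nat.sInf_le ⟨M, hM₁, hM₂, rfl⟩
    exact hd.trans (hL ▸ Submodule.finrank_mono hML)
  have h₀ := key 0 n.zero_le (by rw [mul_zero]; omega)
  have := key (n - dRrel C₁ C₂ + 1) (by omega) hlt
  omega

theorem Rk_transpose {m n : ℕ} (M : Matrix (Fin m) (Fin n) F) : Rk Mᵀ = Rk M := by
  have h {a b : ℕ} (A : Matrix (Fin a) (Fin b) F) : Rk A = A.rank :=
    A.rank_eq_finrank_span_row.symm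
  rw [h, h, rank_transpose]

theorem dRrel_map_transpose {m n : ℕ} (C₁ C₂ : Submodule F (Matrix (Fin m) (Fin n) F)) :
    dRrel (C₁.map (transposeLinearEquiv (Fin m) (Fin n) F F).toLinearMap)
      (C₂.map (transposeLinearEquiv (Fin m) (Fin n) F F).toLinearMap) = dRrel C₁ C₂ := by
  have hmem (C : Submodule F (Matrix (Fin m) (Fin n) F)) (M : Matrix (Fin n) (Fin m) F) :
      M ∈ C.map (transposeLinearEquiv (Fin m) (Fin n) F F).toLinearMap ↔ Mᵀ ∈ C :=
    Submodule.mem_map_equiv C (e := transposeLinearEquiv (Fin m) (Fin n) F F)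
  unfold dRrel
  congr 1
  ext k
  constructor
  · rintro ⟨M, h₁, h₂, rfl⟩
    exact ⟨Mᵀ, (hmem _ _).1 h₁, fun h => h₂ ((hmem _ _).2 h), (Rk_transpose M).symm⟩
  · rintro ⟨M, h₁, h₂, rfl⟩
    exact ⟨Mᵀ, (hmem _ _).2 h₁, fun h => h₂ ((hmem _ _).1 h), (Rk_transpose M).symm⟩

theorem finrank_sub_finrank_le_mul_dRrel_transpose {m n : ℕ}
    (C₁ C₂ : Submodule F (Matrix (Fin m) (Fin n) F)) :
    Module.finrank F C₁ - Module.finrank F C₂ ≤ n * (m - dRrel C₁ C₂ + 1) := by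
  have h := finrank_sub_finrank_le_mul_dRrel
    (C₁.map (transposeLinearEquiv (Fin m) (Fin n) F F).toLinearMap)
    (C₂.map (transposeLinearEquiv (Fin m) (Fin n) F F).toLinearMap)
  rwa [dRrel_map_transpose, LinearEquiv.finrank_map_eq, LinearEquiv.finrank_map_eq] at h

theorem dM_le {m n : ℕ} (hm : 0 < m) {C₁ C₂ : Submodule F (Matrix (Fin m) (Fin n) F)}
    {r ℓ : ℕ} (hℓ : ℓ = Module.finrank F C₁ - Module.finrank F C₂)
    (hr1 : 1 ≤ r) (hr : r ≤ ℓ) :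
    dM C₁ C₂ r ≤ n - ⌈((ℓ - r + 1 : ℕ) : ℚ) / (m : ℚ)⌉₊ + 1 := by
  have hmQ : (0 : ℚ) < m := by exact_mod_cast hm
  have hℓn : ℓ ≤ m * n := hℓ ▸ finrank_sub_finrank_le C₁ C₂
  set t := ⌈((ℓ - r + 1 : ℕ) : ℚ) / (m : ℚ)⌉₊ with ht
  have htn : t ≤ n := by
    rw [ht, Nat.ceil_le, div_le_iff₀ hmQ, mul_comm]
    exact_mod_cast (by omega : ℓ - r + 1 ≤ m * n)
  have htpos : 0 < t := Nat.ceil_pos.2 (by positivity)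
  have hlt : m * (t - 1) < ℓ - r + 1 := by
    have h : ((t - 1 : ℕ) : ℚ) < ((ℓ - r + 1 : ℕ) : ℚ) / (m : ℚ) := Nat.lt_ceil.1 (by omega)
    rw [lt_div_iff₀ hmQ, mul_comm] at h
    exact_mod_cast h
  obtain ⟨L, hL, hLr⟩ := exists_support (C₁ := C₁) (C₂ := C₂) (r := r) (s := t - 1)
    (by omega) (by omega)
  have hd : dM C₁ C₂ r ≤ n - (t - 1) := Nat.sInf_le ⟨L, hL, hLr⟩
  omega

/-- Upper Singleton bound: `d_{M,r}(C₁,C₂) ≤ n - ⌈(ℓ-r+1)/m⌉ + 1` for all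
`1 ≤ r ≤ ℓ`; in particular `dim(C₁/C₂) ≤ max{m,n}·(min{m,n} - d_R(C₁,C₂) + 1)`. -/
theorem stmt_10 (m n : ℕ) (hm : 0 < m) (hn : 0 < n)
    (C₁ C₂ : Submodule F (Matrix (Fin m) (Fin n) F)) (h21 : C₂ ≤ C₁) (hne : C₂ ≠ C₁)
    (ℓ : ℕ) (hℓ : ℓ = Module.finrank F ↥C₁ - Module.finrank F ↥C₂) :
    (∀ r : ℕ, 1 ≤ r → r ≤ ℓ →
      dM C₁ C₂ r ≤ n - ⌈((ℓ - r + 1 : ℕ) : ℚ) / (m : ℚ)⌉₊ + 1) ∧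
    ℓ ≤ max m n * (min m n - dRrel C₁ C₂ + 1) := by
  refine ⟨fun r hr1 hr => dM_le hm hℓ hr1 hr, ?_⟩
  subst hℓ
  obtain hmn | hnm := le_total m n
  · rw [max_eq_right hmn, min_eq_left hmn]
    exact finrank_sub_finrank_le_mul_dRrel_transpose C₁ C₂
  · rw [max_eq_left hnm, min_eq_right hnm]
    exact finrank_sub_finrank_le_mul_dRrel C₁ C₂

end
end
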